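/- arXiv:1403.7776 — 2 statements merged into one kernel-verified Lean document; each statement's English description precedes it below -/
import Mathlib

section
/- Let ε be a splitting on a connected open set U ⊆ ℝⁿ. Then the algebroid curvature 𝔯 vanishes identically on U if and only if the torsion T is ε-parallel. -/
noncomputable section

open Set

/-- The `j`-th coordinate partial derivative of a real-valued function on `ℝⁿ`. -/
noncomputable def pd {n : ℕ} (j : Fin n) (f : (Fin n → ℝ) → ℝ) (x : Fin n → ℝ) : ℝ :=
  fderiv ℝ f x (Pi.single j 1)

/-- A splitting `ε` on `U`: a smooth groupoid homomorphism `U × U → GL(n,ℝ)`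
satisfying `ε(z,y)ε(x,z) = ε(x,y)` and `ε(x,x) = id`. -/
structure IsSplitting {n : ℕ} (U : Set (Fin n → ℝ))
    (eps : (Fin n → ℝ) → (Fin n → ℝ) → Fin n → Fin n → ℝ) : Prop where
  smooth : ∀ i j : Fin n, ContDiffOn ℝ (⊤ : ℕ∞)
    (fun p : (Fin n → ℝ) × (Fin n → ℝ) => eps p.1 p.2 i j) (U ×ˢ U)
  comp : ∀ x ∈ U, ∀ y ∈ U, ∀ z ∈ U, ∀ i j : Fin n,
    (∑ a, eps z y i a * eps x z a j) = eps x y i j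
  refl : ∀ x ∈ U, ∀ i j : Fin n, eps x x i j = if i = j then (1 : ℝ) else 0

/-- `Γ^i_{jk}(x) = (∂ε^i_k(x,y)/∂y^j)|_{y=x}`. -/
noncomputable def Gam {n : ℕ} (eps : (Fin n → ℝ) → (Fin n → ℝ) → Fin n → Fin n → ℝ)
    (i j k : Fin n) (x : Fin n → ℝ) : ℝ :=
  pd j (fun y => eps x y i k) x

/-- The groupoid curvature `R^i_{jk}(x,y)`. -/
noncomputable def Rg {n : ℕ} (eps : (Fin n → ℝ) → (Fin n → ℝ) → Fin n → Fin n → ℝ)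
    (i j k : Fin n) (x y : Fin n → ℝ) : ℝ :=
  pd j (fun x' => eps x' y i k) x + ∑ a, pd a (fun y' => eps x y' i k) y * eps x y a j
    - pd k (fun x' => eps x' y i j) x - ∑ a, pd a (fun y' => eps x y' i j) y * eps x y a k

/-- The algebroid curvature `𝔯^i_{jk,r}(x)`. -/
noncomputable def ra {n : ℕ} (eps : (Fin n → ℝ) → (Fin n → ℝ) → Fin n → Fin n → ℝ)
    (i j k r : Fin n) (x : Fin n → ℝ) : ℝ :=
  pd j (Gam eps i r k) x + ∑ a, Gam eps a r j x * Gam eps i a k x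
    - pd k (Gam eps i r j) x - ∑ a, Gam eps a r k x * Gam eps i a j x

/-- The torsion `T^i_{jk} = Γ^i_{jk} − Γ^i_{kj}`. -/
noncomputable def Tor {n : ℕ} (eps : (Fin n → ℝ) → (Fin n → ℝ) → Fin n → Fin n → ℝ)
    (i j k : Fin n) (x : Fin n → ℝ) : ℝ :=
  Gam eps i j k x - Gam eps i k j x

/-- A vector field `ξ` is `ε`-parallel if `ξ^i(y) = ε^i_a(x,y) ξ^a(x)` for all `x, y ∈ U`. -/
def EpsParallelVF {n : ℕ} (U : Set (Fin n → ℝ))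
    (eps : (Fin n → ℝ) → (Fin n → ℝ) → Fin n → Fin n → ℝ)
    (ξ : (Fin n → ℝ) → Fin n → ℝ) : Prop :=
  ∀ x ∈ U, ∀ y ∈ U, ∀ i, ξ y i = ∑ a, eps x y i a * ξ x a

section PartialDerivatives

variable {n : ℕ} {j l : Fin n} {f g : (Fin n → ℝ) → ℝ} {x : Fin n → ℝ}

theorem pd_congr (h : f =ᶠ[nhds x] g) : pd j f x = pd j g x := by
  unfold pd
  rw [h.fderiv_eq]

theorem pd_sub (hf : DifferentiableAt ℝ f x) (hg : DifferentiableAt ℝ g x) :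
    pd j (fun y => f y - g y) x = pd j f x - pd j g x := by
  unfold pd
  rw [fderiv_fun_sub hf hg]
  rfl

theorem pd_mul (hf : DifferentiableAt ℝ f x) (hg : DifferentiableAt ℝ g x) :
    pd j (fun y => f y * g y) x = pd j f x * g x + f x * pd j g x := by
  unfold pd
  rw [fderiv_fun_mul hf hg]
  simp
  ring

theorem pd_sum {ι : Type*} {s : Finset ι} {F : ι → (Fin n → ℝ) → ℝ}
    (hF : ∀ a ∈ s, DifferentiableAt ℝ (F a) x) :
    pd j (fun y => ∑ a ∈ s, F a y) x = ∑ a ∈ s, pd j (F a) x := by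
  unfold pd
  rw [fderiv_fun_sum hF]
  simp

theorem pd_const (c : ℝ) : pd j (fun _ => c) x = 0 := by
  simp [pd]

theorem fderiv_eq_zero_of_pd_eq_zero (h : ∀ j, pd j f x = 0) : fderiv ℝ f x = 0 := by
  ext v
  rw [← Finset.univ_sum_single v, map_sum]
  refine Finset.sum_eq_zero fun j _ => ?_
  have : (Pi.single j (v j) : Fin n → ℝ) = v j • Pi.single j (1 : ℝ) := by
    rw [← Pi.single_smul]
    simp
  rw [this, map_smul]
  simpa [pd] using Or.inr (h j)

theorem ContDiffAt.pd {m k : WithTop ℕ∞} (hf : ContDiffAt ℝ k f x) (hmk : m + 1 ≤ k) :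
    ContDiffAt ℝ m (pd j f) x :=
  (hf.fderiv_right hmk).clm_apply contDiffAt_const

theorem pd_comm (hf : ContDiffAt ℝ 2 f x) : pd j (pd l f) x = pd l (pd j f) x := by
  have hd : DifferentiableAt ℝ (fderiv ℝ f) x :=
    (hf.fderiv_right (m := 1) (by norm_num)).differentiableAt (by norm_num)
  have key : ∀ a b : Fin n, pd a (pd b f) x
      = fderiv ℝ (fderiv ℝ f) x (Pi.single a 1) (Pi.single b 1) := by
    intro a b
    change fderiv ℝ (fun y => fderiv ℝ f y (Pi.single b 1)) x (Pi.single a 1) = _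
    rw [fderiv_clm_apply hd (differentiableAt_const _)]
    simp
  rw [key, key]
  exact (hf.isSymmSndFDerivAt (by simp)) _ _

end PartialDerivatives

theorem sum_swap_outer_inner {ι M : Type*} [Fintype ι] [AddCommMonoid M] (F : ι → ι → ι → M) :
    ∑ a, ∑ b, ∑ c, F a b c = ∑ a, ∑ b, ∑ c, F c b a := by
  rw [Finset.sum_comm]
  simp_rw [Finset.sum_comm (γ := ι) (f := fun a c => F a _ c)]
  rw [Finset.sum_comm]

namespace IsSplitting

variable {n : ℕ} {U : Set (Fin n → ℝ)} {eps : (Fin n → ℝ) → (Fin n → ℝ) → Fin n → Fin n → ℝ}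
  {x y : Fin n → ℝ}

theorem contDiffAt (heps : IsSplitting U eps) (hU : IsOpen U) (hx : x ∈ U) (hy : y ∈ U)
    (i k : Fin n) :
    ContDiffAt ℝ (⊤ : ℕ∞) (fun p : (Fin n → ℝ) × (Fin n → ℝ) => eps p.1 p.2 i k) (x, y) :=
  (heps.smooth i k).contDiffAt ((hU.prod hU).mem_nhds ⟨hx, hy⟩)

theorem contDiffAt_right (heps : IsSplitting U eps) (hU : IsOpen U) (hx : x ∈ U) (hy : y ∈ U)
    (i k : Fin n) : ContDiffAt ℝ (⊤ : ℕ∞) (fun z => eps x z i k) y :=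
  ContDiffAt.comp y (heps.contDiffAt hU hx hy i k) (contDiffAt_const.prodMk contDiffAt_id)

theorem contDiffAt_left (heps : IsSplitting U eps) (hU : IsOpen U) (hx : x ∈ U) (hy : y ∈ U)
    (i k : Fin n) : ContDiffAt ℝ (⊤ : ℕ∞) (fun z => eps z y i k) x :=
  ContDiffAt.comp x (heps.contDiffAt hU hx hy i k) (contDiffAt_id.prodMk contDiffAt_const)

theorem differentiableAt_right (heps : IsSplitting U eps) (hU : IsOpen U) (hx : x ∈ U)
    (hy : y ∈ U) (i k : Fin n) : DifferentiableAt ℝ (fun z => eps x z i k) y :=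
  (heps.contDiffAt_right hU hx hy i k).differentiableAt (by simp)

theorem differentiableAt_left (heps : IsSplitting U eps) (hU : IsOpen U) (hx : x ∈ U)
    (hy : y ∈ U) (i k : Fin n) : DifferentiableAt ℝ (fun z => eps z y i k) x :=
  (heps.contDiffAt_left hU hx hy i k).differentiableAt (by simp)

theorem pd_right (heps : IsSplitting U eps) (hU : IsOpen U) (hx : x ∈ U) (hy : y ∈ U)
    (r i k : Fin n) :
    pd r (fun z => eps x z i k) y = ∑ a, Gam eps i r a y * eps x y a k := by
  have h : (fun z => eps x z i k) =ᶠ[nhds y] fun z => ∑ a, eps y z i a * eps x y a k := by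
    filter_upwards [hU.mem_nhds hy] with z hz
    exact (heps.comp x hx z hz y hy i k).symm
  have hd := heps.differentiableAt_right hU hy hy
  rw [pd_congr h, pd_sum fun a _ => (hd i a).mul_const _]
  refine Finset.sum_congr rfl fun a _ => ?_
  rw [pd_mul (hd i a) (differentiableAt_const _), pd_const, mul_zero, add_zero, Gam]

theorem pd_left_self (heps : IsSplitting U eps) (hU : IsOpen U) (hx : x ∈ U) (r i k : Fin n) :
    pd r (fun z => eps z x i k) x = -Gam eps i r k x := by
  have h : (fun z => ∑ a, eps z x i a * eps x z a k) =ᶠ[nhds x] fun _ => eps x x i k := by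
    filter_upwards [hU.mem_nhds hx] with z hz
    exact heps.comp x hx x hx z hz i k
  have hr := heps.differentiableAt_right hU hx hx
  have hl := heps.differentiableAt_left hU hx hx
  have := pd_congr (j := r) h
  rw [pd_const, pd_sum fun a _ => (hl i a).fun_mul (hr a k)] at this
  simp only [pd_mul (hl i _) (hr _ k), heps.refl x hx, mul_ite, ite_mul, mul_one, one_mul,
    mul_zero, zero_mul, Finset.sum_add_distrib, Finset.sum_ite_eq, Finset.sum_ite_eq',
    Finset.mem_univ, if_true] at this
  exact eq_neg_of_add_eq_zero_left this

theorem pd_left (heps : IsSplitting U eps) (hU : IsOpen U) (hx : x ∈ U) (hy : y ∈ U)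
    (r i k : Fin n) :
    pd r (fun z => eps z x i k) y = -∑ a, eps y x i a * Gam eps a r k y := by
  have h : (fun z => eps z x i k) =ᶠ[nhds y] fun z => ∑ a, eps y x i a * eps z y a k := by
    filter_upwards [hU.mem_nhds hy] with z hz
    exact (heps.comp z hz x hx y hy i k).symm
  have hd := heps.differentiableAt_left hU hy hy
  rw [pd_congr h, pd_sum fun a _ => (hd a k).const_mul _, ← Finset.sum_neg_distrib]
  refine Finset.sum_congr rfl fun a _ => ?_
  rw [pd_mul (differentiableAt_const _) (hd a k), pd_const, heps.pd_left_self hU hy]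
  ring

theorem differentiableAt_gam (heps : IsSplitting U eps) (hU : IsOpen U) (hx : x ∈ U)
    (i r k : Fin n) : DifferentiableAt ℝ (Gam eps i r k) x := by
  have h : Gam eps i r k =ᶠ[nhds x]
      fun z => ∑ a, pd r (fun w => eps x w i a) z * eps z x a k := by
    filter_upwards [hU.mem_nhds hx] with z hz
    simp only [heps.pd_right hU hx hz, Finset.sum_mul, mul_assoc]
    rw [Finset.sum_comm]
    simp [← Finset.mul_sum, heps.comp z hz z hz x hx, heps.refl z hz]
  refine DifferentiableAt.congr_of_eventuallyEq (.fun_sum fun a _ => .fun_mul ?_ ?_) h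
  · exact ((heps.contDiffAt_right hU hx hx i a).pd (m := 1)
      (by norm_cast)).differentiableAt (by simp)
  · exact heps.differentiableAt_left hU hx hx a k

theorem pd_gam_add_comm (heps : IsSplitting U eps) (hU : IsOpen U) (hx : x ∈ U)
    (i j l k : Fin n) :
    pd j (Gam eps i l k) x + ∑ a, Gam eps i l a x * Gam eps a j k x
      = pd l (Gam eps i j k) x + ∑ a, Gam eps i j a x * Gam eps a l k x := by
  have key : ∀ p q : Fin n, pd p (pd q fun z => eps x z i k) x
      = pd p (Gam eps i q k) x + ∑ a, Gam eps i q a x * Gam eps a p k x := by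
    intro p q
    have h : (pd q fun z => eps x z i k) =ᶠ[nhds x]
        fun z => ∑ a, Gam eps i q a z * eps x z a k := by
      filter_upwards [hU.mem_nhds hx] with z hz
      exact heps.pd_right hU hx hz q i k
    have hg := heps.differentiableAt_gam hU hx i q
    have hr := heps.differentiableAt_right hU hx hx
    rw [pd_congr h, pd_sum fun a _ => (hg a).fun_mul (hr a k)]
    simp only [pd_mul (hg _) (hr _ k), heps.pd_right hU hx hx, Finset.sum_add_distrib]
    simp [heps.refl x hx]
  rw [← key, ← key]
  exact pd_comm ((heps.contDiffAt_right hU hx hx i k).of_le (by norm_cast))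

theorem differentiableAt_tor (heps : IsSplitting U eps) (hU : IsOpen U) (hx : x ∈ U)
    (i j k : Fin n) : DifferentiableAt ℝ (Tor eps i j k) x :=
  (heps.differentiableAt_gam hU hx i j k).sub (heps.differentiableAt_gam hU hx i k j)

/-- The algebroid curvature is the covariant derivative of the torsion. -/
theorem ra_eq_covariant_deriv_tor (heps : IsSplitting U eps) (hU : IsOpen U) (hx : x ∈ U)
    (i j k r : Fin n) :
    ra eps i j k r x = pd r (Tor eps i j k) x - ∑ a, Gam eps i r a x * Tor eps a j k x
      + ∑ a, Tor eps i a k x * Gam eps a r j x + ∑ a, Tor eps i j a x * Gam eps a r k x := by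
  have hT : pd r (Tor eps i j k) x = pd r (Gam eps i j k) x - pd r (Gam eps i k j) x :=
    pd_sub (heps.differentiableAt_gam hU hx i j k) (heps.differentiableAt_gam hU hx i k j)
  have h1 := heps.pd_gam_add_comm hU hx i r j k
  have h2 := heps.pd_gam_add_comm hU hx i r k j
  rw [hT]
  simp only [ra, Tor, mul_sub, sub_mul, Finset.sum_sub_distrib]
  simp only [mul_comm (Gam eps _ r j x), mul_comm (Gam eps _ r k x)] at h1 h2 ⊢
  linarith

/-- The torsion at `y` transported to `x`. -/
def transportedTor (eps : (Fin n → ℝ) → (Fin n → ℝ) → Fin n → Fin n → ℝ) (x : Fin n → ℝ)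
    (i j k : Fin n) (y : Fin n → ℝ) : ℝ :=
  ∑ a, ∑ b, ∑ c, eps y x i a * Tor eps a b c y * eps x y b j * eps x y c k

theorem transportedTor_self (heps : IsSplitting U eps) (hx : x ∈ U) (i j k : Fin n) :
    transportedTor eps x i j k x = Tor eps i j k x := by
  simp [transportedTor, heps.refl x hx]

theorem differentiableAt_transportedTor (heps : IsSplitting U eps) (hU : IsOpen U) (hx : x ∈ U)
    (hy : y ∈ U) (i j k : Fin n) : DifferentiableAt ℝ (transportedTor eps x i j k) y :=
  .fun_sum fun a _ => .fun_sum fun b _ => .fun_sum fun c _ =>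
    (((heps.differentiableAt_left hU hy hx i a).fun_mul (heps.differentiableAt_tor hU hy a b c)).mul
      (heps.differentiableAt_right hU hx hy b j)).fun_mul (heps.differentiableAt_right hU hx hy c k)

theorem pd_transportedTor (heps : IsSplitting U eps) (hU : IsOpen U) (hx : x ∈ U) (hy : y ∈ U)
    (r i j k : Fin n) :
    pd r (transportedTor eps x i j k) y
      = ∑ a, ∑ b, ∑ c, eps y x i a * ra eps a b c r y * eps x y b j * eps x y c k := by
  have hl := heps.differentiableAt_left hU hy hx
  have hr := heps.differentiableAt_right hU hx hy
  have hT := heps.differentiableAt_tor hU hy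
  have h1 := fun a b c => (hl i a).fun_mul (hT a b c)
  have h2 := fun a b c => (h1 a b c).fun_mul (hr b j)
  have h3 := fun a b c => (h2 a b c).fun_mul (hr c k)
  have hterm : ∀ a b c, pd r (fun z => eps z x i a * Tor eps a b c z * eps x z b j * eps x z c k) y
      = -(∑ d, eps y x i d * Gam eps d r a y * Tor eps a b c y * eps x y b j * eps x y c k)
        + eps y x i a * pd r (Tor eps a b c) y * eps x y b j * eps x y c k
        + ∑ d, eps y x i a * Tor eps a b c y * Gam eps b r d y * eps x y d j * eps x y c k
        + ∑ d, eps y x i a * Tor eps a b c y * eps x y b j * Gam eps c r d y * eps x y d k := by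
    intro a b c
    refine (pd_mul (h2 a b c) (hr c k)).trans ?_
    rw [show pd r (fun z => eps z x i a * Tor eps a b c z * eps x z b j) y = _ from
      pd_mul (h1 a b c) (hr b j), show pd r (fun z => eps z x i a * Tor eps a b c z) y = _ from
      pd_mul (hl i a) (hT a b c), heps.pd_left hU hx hy, heps.pd_right hU hx hy,
      heps.pd_right hU hx hy]
    simp only [add_mul, neg_mul, Finset.sum_mul, Finset.mul_sum, mul_assoc]
  have hL : pd r (transportedTor eps x i j k) y = ∑ a, ∑ b, ∑ c,
      pd r (fun z => eps z x i a * Tor eps a b c z * eps x z b j * eps x z c k) y := by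
    refine (pd_sum fun a _ => .fun_sum fun b _ => .fun_sum fun c _ => h3 a b c).trans ?_
    refine Finset.sum_congr rfl fun a _ => ?_
    refine (pd_sum fun b _ => .fun_sum fun c _ => h3 a b c).trans ?_
    exact Finset.sum_congr rfl fun b _ => pd_sum fun c _ => h3 a b c
  have hfirst : ∑ a, ∑ b, ∑ c, ∑ d,
        eps y x i d * Gam eps d r a y * Tor eps a b c y * eps x y b j * eps x y c k
      = ∑ a, ∑ b, ∑ c,
        eps y x i a * (∑ d, Gam eps a r d y * Tor eps d b c y) * eps x y b j * eps x y c k := by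
    rw [Finset.sum_comm]
    simp only [sum_swap_outer_inner fun a c d =>
      eps y x i d * Gam eps d r a y * Tor eps a _ c y * eps x y _ j * eps x y c k]
    rw [Finset.sum_comm]
    simp only [Finset.mul_sum, Finset.sum_mul, mul_assoc]
  have hsecond : ∑ a, ∑ b, ∑ c, ∑ d,
        eps y x i a * Tor eps a b c y * Gam eps b r d y * eps x y d j * eps x y c k
      = ∑ a, ∑ b, ∑ c,
        eps y x i a * (∑ d, Tor eps a d c y * Gam eps d r b y) * eps x y b j * eps x y c k := by
    simp only [sum_swap_outer_inner fun b c d =>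
      eps y x i _ * Tor eps _ b c y * Gam eps b r d y * eps x y d j * eps x y c k]
    simp only [Finset.mul_sum, Finset.sum_mul, mul_assoc]
  have hthird : ∑ a, ∑ b, ∑ c, ∑ d,
        eps y x i a * Tor eps a b c y * eps x y b j * Gam eps c r d y * eps x y d k
      = ∑ a, ∑ b, ∑ c,
        eps y x i a * (∑ d, Tor eps a b d y * Gam eps d r c y) * eps x y b j * eps x y c k := by
    refine Finset.sum_congr rfl fun a _ => Finset.sum_congr rfl fun b _ => ?_
    rw [Finset.sum_comm]
    simp only [Finset.mul_sum, Finset.sum_mul]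
    exact Finset.sum_congr rfl fun c _ => Finset.sum_congr rfl fun d _ => by ring
  rw [hL]
  simp only [hterm, Finset.sum_add_distrib, Finset.sum_neg_distrib]
  rw [hfirst, hsecond, hthird]
  simp only [← Finset.sum_add_distrib, ← Finset.sum_neg_distrib]
  refine Finset.sum_congr rfl fun a _ => Finset.sum_congr rfl fun b _ =>
    Finset.sum_congr rfl fun c _ => ?_
  rw [heps.ra_eq_covariant_deriv_tor hU hy]
  ring

end IsSplitting

/-- `𝔯 ≡ 0` on connected open `U` iff the torsion `T` is `ε`-parallel
as a (1,2)-tensor: `T^i_{jk}(y) = ε^i_a(x,y) T^a_{bc}(x) ε^b_j(y,x) ε^c_k(y,x)`. -/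
theorem stmt_9 {n : ℕ} (hn : 2 ≤ n) (U : Set (Fin n → ℝ)) (hU : IsOpen U)
    (hUconn : IsConnected U)
    (eps : (Fin n → ℝ) → (Fin n → ℝ) → Fin n → Fin n → ℝ) (heps : IsSplitting U eps) :
    (∀ x ∈ U, ∀ i j k r : Fin n, ra eps i j k r x = 0) ↔
      (∀ x ∈ U, ∀ y ∈ U, ∀ i j k : Fin n,
        Tor eps i j k y =
          ∑ a, ∑ b, ∑ c, eps x y i a * Tor eps a b c x * eps y x b j * eps y x c k) := by
  have hpar : (∀ x ∈ U, ∀ y ∈ U, ∀ i j k : Fin n, Tor eps i j k y =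
        ∑ a, ∑ b, ∑ c, eps x y i a * Tor eps a b c x * eps y x b j * eps y x c k) ↔
      ∀ x ∈ U, ∀ y ∈ U, ∀ i j k : Fin n,
        IsSplitting.transportedTor eps x i j k y = Tor eps i j k x :=
    ⟨fun h x hx y hy i j k => (h y hy x hx i j k).symm,
      fun h x hx y hy i j k => (h y hy x hx i j k).symm⟩
  rw [hpar]
  constructor
  · intro h x hx y hy i j k
    rw [← heps.transportedTor_self hx]
    refine hU.is_const_of_fderiv_eq_zero hUconn.isPreconnected
      (fun z hz => (heps.differentiableAt_transportedTor hU hx hz i j k).differentiableWithinAt)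
      (fun z hz => fderiv_eq_zero_of_pd_eq_zero fun r => ?_) hy hx
    rw [heps.pd_transportedTor hU hx hz]
    simp [h z hz]
  · intro h x hx i j k r
    have hc : IsSplitting.transportedTor eps x i j k =ᶠ[nhds x] fun _ => Tor eps i j k x := by
      filter_upwards [hU.mem_nhds hx] with z hz
      exact h x hx z hz i j k
    have hd := heps.pd_transportedTor hU hx hx r i j k
    rw [pd_congr hc, pd_const] at hd
    simpa [heps.refl x hx] using hd.symm
end
end

section
/- Let ε be a splitting on an open set U ⊆ ℝⁿ, fix a basepoint p ∈ U, and let g be the canonical metric. Then g is ∇-parallel: for all x ∈ U and all indices r,i,j, ∂g_{ij}(x)/∂x^r + Γ^a_{ri}(x) g_{aj}(x) + Γ^a_{rj}(x) g_{ia}(x) = 0. -/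
noncomputable section

open Set

/-- The canonical metric `g_{ij}(x) = Σ_a ε^a_i(x,p) ε^a_j(x,p)` of `(M,ε)` with
basepoint `p`. -/
noncomputable def canG {n : ℕ} (eps : (Fin n → ℝ) → (Fin n → ℝ) → Fin n → Fin n → ℝ)
    (p : Fin n → ℝ) (i j : Fin n) (x : Fin n → ℝ) : ℝ :=
  ∑ a, eps x p a i * eps x p a j

theorem IsSplitting.differentiableAt {n : ℕ} {U : Set (Fin n → ℝ)} (hU : IsOpen U)
    {eps : (Fin n → ℝ) → (Fin n → ℝ) → Fin n → Fin n → ℝ} (heps : IsSplitting U eps)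
    {x y : Fin n → ℝ} (hx : x ∈ U) (hy : y ∈ U) (i j : Fin n) :
    DifferentiableAt ℝ (fun q : (Fin n → ℝ) × (Fin n → ℝ) => eps q.1 q.2 i j) (x, y) :=
  ((heps.smooth i j).differentiableOn (by simp)).differentiableAt
    ((hU.prod hU).mem_nhds ⟨hx, hy⟩)

theorem IsSplitting.differentiableAt_left_s14 {n : ℕ} {U : Set (Fin n → ℝ)} (hU : IsOpen U)
    {eps : (Fin n → ℝ) → (Fin n → ℝ) → Fin n → Fin n → ℝ} (heps : IsSplitting U eps)
    {x y : Fin n → ℝ} (hx : x ∈ U) (hy : y ∈ U) (i j : Fin n) :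
    DifferentiableAt ℝ (fun x' => eps x' y i j) x :=
  DifferentiableAt.comp (f := fun x' => (x', y)) x (heps.differentiableAt hU hx hy i j)
    (by fun_prop)

theorem IsSplitting.differentiableAt_right_s14 {n : ℕ} {U : Set (Fin n → ℝ)} (hU : IsOpen U)
    {eps : (Fin n → ℝ) → (Fin n → ℝ) → Fin n → Fin n → ℝ} (heps : IsSplitting U eps)
    {x y : Fin n → ℝ} (hx : x ∈ U) (hy : y ∈ U) (i j : Fin n) :
    DifferentiableAt ℝ (fun y' => eps x y' i j) y :=
  DifferentiableAt.comp (f := fun y' => (x, y')) y (heps.differentiableAt hU hx hy i j)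
    (by fun_prop)

theorem pd_sum_mul {n : ℕ} {ι : Type*} [Fintype ι] {f g : ι → (Fin n → ℝ) → ℝ}
    {x : Fin n → ℝ} (hf : ∀ a, DifferentiableAt ℝ (f a) x)
    (hg : ∀ a, DifferentiableAt ℝ (g a) x) (r : Fin n) :
    pd r (fun y => ∑ a, f a y * g a y) x
      = ∑ a, (f a x * pd r (g a) x + g a x * pd r (f a) x) := by
  have h : HasFDerivAt (fun y => ∑ a, f a y * g a y)
      (∑ a, (f a x • fderiv ℝ (g a) x + g a x • fderiv ℝ (f a) x)) x :=
    HasFDerivAt.fun_sum fun a _ => (hf a).hasFDerivAt.mul (hg a).hasFDerivAt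
  simp [pd, h.fderiv]

/-- The derivative of a splitting in its source variable is determined by `Γ`. -/
theorem IsSplitting.pd_left_s14 {n : ℕ} {U : Set (Fin n → ℝ)} (hU : IsOpen U)
    {eps : (Fin n → ℝ) → (Fin n → ℝ) → Fin n → Fin n → ℝ} (heps : IsSplitting U eps)
    {x p : Fin n → ℝ} (hx : x ∈ U) (hp : p ∈ U) (r i j : Fin n) :
    pd r (fun y => eps y p i j) x = -∑ b, eps x p i b * Gam eps b r j x := by
  have hconst : pd r (fun y => ∑ b, eps y p i b * eps x y b j) x = 0 := by
    have h : (fun y => ∑ b, eps y p i b * eps x y b j)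
        =ᶠ[nhds x] fun _ => eps x p i j := by
      filter_upwards [hU.mem_nhds hx] with y hy using heps.comp x hx p hp y hy i j
    simp [pd, h.fderiv_eq]
  rw [pd_sum_mul (fun b => heps.differentiableAt_left_s14 hU hx hp i b)
    (fun b => heps.differentiableAt_right_s14 hU hx hx b j), Finset.sum_add_distrib] at hconst
  simp only [heps.refl x hx, ite_mul, one_mul, zero_mul, Finset.sum_ite_eq',
    Finset.mem_univ, if_true] at hconst
  simp only [Gam]
  linarith

/-- The canonical metric is `∇`-parallel:
`∂g_{ij}/∂x^r + Γ^a_{ri} g_{aj} + Γ^a_{rj} g_{ia} = 0`. -/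
theorem stmt_14 {n : ℕ} (hn : 2 ≤ n) (U : Set (Fin n → ℝ)) (hU : IsOpen U)
    (eps : (Fin n → ℝ) → (Fin n → ℝ) → Fin n → Fin n → ℝ) (heps : IsSplitting U eps)
    (p : Fin n → ℝ) (hp : p ∈ U) :
    ∀ x ∈ U, ∀ r i j : Fin n,
      pd r (canG eps p i j) x + ∑ a, Gam eps a r i x * canG eps p a j x
        + ∑ a, Gam eps a r j x * canG eps p i a x = 0 := by
  intro x hx r i j
  have h : pd r (canG eps p i j) x = _ :=
    pd_sum_mul (fun a => heps.differentiableAt_left_s14 hU hx hp a i)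
      (fun a => heps.differentiableAt_left_s14 hU hx hp a j) r
  rw [h]
  have hi : ∑ a, Gam eps a r i x * canG eps p a j x
      = ∑ a, eps x p a j * ∑ b, eps x p a b * Gam eps b r i x := by
    simp only [canG, Finset.mul_sum]
    rw [Finset.sum_comm]
    exact Finset.sum_congr rfl fun a _ => Finset.sum_congr rfl fun b _ => by ring
  have hj : ∑ a, Gam eps a r j x * canG eps p i a x
      = ∑ a, eps x p a i * ∑ b, eps x p a b * Gam eps b r j x := by
    simp only [canG, Finset.mul_sum]
    rw [Finset.sum_comm]
    exact Finset.sum_congr rfl fun a _ => Finset.sum_congr rfl fun b _ => by ring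
  rw [hi, hj, ← Finset.sum_add_distrib, ← Finset.sum_add_distrib]
  refine Finset.sum_eq_zero fun a _ => ?_
  rw [heps.pd_left_s14 hU hx hp, heps.pd_left_s14 hU hx hp]
  ring
end
end
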